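/- Let f ∈ ℂ[z₁,…,zₙ] be a polynomial and let y ∈ ℂⁿ be nonzero. Consider the fiber of the logarithmic Gauss map over (y₁:…:yₙ), i.e. the set S := {z ∈ (ℂ∖{0})ⁿ : f(z) = 0 and yⱼ·zᵢ·∂f/∂zᵢ(z) = yᵢ·zⱼ·∂f/∂zⱼ(z) for all 1 ≤ i, j ≤ n}. If S is finite, then its cardinality is at most n!·Volₙ(N_f), where Volₙ(N_f) is the n-dimensional Lebesgue measure of the Newton polytope of f. -/

import Mathlib

open MvPolynomial

namespace GaussFiber

section PowerProducts

variable {σ k R : Type*} [CommRing R]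

/-- The product of the powers `g i ^ α i`. -/
noncomputable def powProd (g : σ → R) (α : σ →₀ ℕ) : R :=
  α.prod fun i e => g i ^ e

lemma powProd_add (g : σ → R) (α β : σ →₀ ℕ) :
    powProd g (α + β) = powProd g α * powProd g β :=
  Finsupp.prod_add_index' (fun i => pow_zero (g i)) (fun i => pow_add (g i))

lemma span_range_pow (g : σ → R) (j : ℕ) :
    Ideal.span (Set.range g) ^ j = Ideal.span (powProd g '' {α | α.degree = j}) := by
  rw [Ideal.span, Submodule.span_pow, ← Set.image_univ, Finsupp.image_pow_eq_finsuppProd_image]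
  simp [Finsupp.degree]
  rfl

lemma powProd_mem (g : σ → R) (α : σ →₀ ℕ) :
    powProd g α ∈ Ideal.span (Set.range g) ^ α.degree := by
  rw [span_range_pow]
  exact Ideal.subset_span ⟨α, rfl, rfl⟩

variable [Field k] [Algebra k R]

lemma aeval_eq_sum_powProd (g : σ → R) (φ : MvPolynomial σ k) :
    aeval g φ = ∑ δ ∈ φ.support, φ.coeff δ • powProd g δ := by
  simp [aeval_def, eval₂_eq, Algebra.smul_def, powProd, Finsupp.prod]

/-- If a nonzero form `φ` of degree `d` takes a value in `m * I ^ d` at generators of `I`, then the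
power products of the generators which are not multiples of the leading one of `φ`
suffice modulo `m`. -/
lemma powProd_mem_span_sup (o : MonomialOrder σ) (g : σ → R) (m : Ideal R) {d : ℕ}
    {φ : MvPolynomial σ k} (hφ : φ.IsHomogeneous d) (hφ0 : φ ≠ 0)
    (h : aeval g φ ∈ m * Ideal.span (Set.range g) ^ d) (α : σ →₀ ℕ) :
    powProd g α ∈ Ideal.span (powProd g '' {δ | δ.degree = α.degree ∧ ¬ o.degree φ ≤ δ}) ⊔
      m * Ideal.span (Set.range g) ^ α.degree := by
  classical
  induction α using (InvImage.wf o.toSyn wellFounded_lt).induction with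
  | _ α ih =>
  by_cases hα : o.degree φ ≤ α
  swap
  · exact Ideal.mem_sup_left (Ideal.subset_span ⟨α, ⟨rfl, hα⟩, rfl⟩)
  obtain ⟨γ, rfl⟩ := exists_add_of_le hα
  have hdeg : ∀ δ ∈ φ.support, δ.degree = d := by
    intro δ hδ
    have := hφ (mem_support_iff.1 hδ)
    rw [Finsupp.degree_eq_weight_one]
    exact this
  have hmem : o.degree φ ∈ φ.support := o.degree_mem_support hφ0
  have hc : φ.coeff (o.degree φ) ≠ 0 := mem_support_iff.1 hmem
  set J := Ideal.span (powProd g '' {δ | δ.degree = (o.degree φ + γ).degree ∧ ¬ o.degree φ ≤ δ}) ⊔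
      m * Ideal.span (Set.range g) ^ (o.degree φ + γ).degree with hJ
  have hsum := aeval_eq_sum_powProd g φ
  rw [← Finset.add_sum_erase _ _ hmem] at hsum
  have h1 : aeval g φ * powProd g γ ∈ J := by
    refine Ideal.mem_sup_right ?_
    rw [map_add, hdeg _ hmem, pow_add, ← mul_assoc]
    exact Ideal.mul_mem_mul h (powProd_mem g γ)
  have h2 : (∑ δ ∈ φ.support.erase (o.degree φ), φ.coeff δ • powProd g δ) * powProd g γ ∈ J := by
    rw [Finset.sum_mul]
    refine Ideal.sum_mem _ fun δ hδ => ?_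
    obtain ⟨hne, hδ⟩ := Finset.mem_erase.1 hδ
    rw [smul_mul_assoc, ← powProd_add, Algebra.smul_def]
    refine Ideal.mul_mem_left _ _ ?_
    have hlt : o.toSyn (δ + γ) < o.toSyn (o.degree φ + γ) := by
      rw [map_add, map_add]
      exact add_lt_add_left
        (lt_of_le_of_ne (o.le_degree hδ) fun e => hne (o.toSyn.injective e)) _
    have := ih (δ + γ) hlt
    have e : (δ + γ).degree = (o.degree φ + γ).degree := by
      rw [map_add, map_add, hdeg δ hδ, hdeg _ hmem]
    rwa [e] at this
  have h3 : φ.coeff (o.degree φ) • powProd g (o.degree φ + γ) ∈ J := by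
    have := J.sub_mem h1 h2
    rwa [hsum, add_mul, add_sub_cancel_right, smul_mul_assoc, ← powProd_add] at this
  have h4 := J.mul_mem_left (algebraMap k R (φ.coeff (o.degree φ))⁻¹) h3
  rwa [← Algebra.smul_def, inv_smul_smul₀ hc] at h4

lemma span_range_pow_le (o : MonomialOrder σ) (g : σ → R) (m : Ideal R) {d : ℕ}
    {φ : MvPolynomial σ k} (hφ : φ.IsHomogeneous d) (hφ0 : φ ≠ 0)
    (h : aeval g φ ∈ m * Ideal.span (Set.range g) ^ d) (j t : ℕ) :
    Ideal.span (Set.range g) ^ j ≤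
      Ideal.span (powProd g '' {δ | δ.degree = j ∧ ¬ o.degree φ ≤ δ}) ⊔
      m ^ t * Ideal.span (Set.range g) ^ j := by
  set E := Ideal.span (powProd g '' {δ | δ.degree = j ∧ ¬ o.degree φ ≤ δ})
  have base : Ideal.span (Set.range g) ^ j ≤ E ⊔ m * Ideal.span (Set.range g) ^ j := by
    conv_lhs => rw [span_range_pow]
    rw [Ideal.span_le]
    rintro _ ⟨α, rfl, rfl⟩
    exact powProd_mem_span_sup o g m hφ hφ0 h α
  induction t with
  | zero => simp
  | succ t ih =>
    refine ih.trans (sup_le le_sup_left ?_)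
    refine (Ideal.mul_mono_right base).trans ?_
    rw [Ideal.mul_sup, ← mul_assoc, ← pow_succ]
    exact sup_le_sup_right Ideal.mul_le_right _

/-- The spanning statement behind the dimension count. -/
lemma top_le_mul_span_sup (o : MonomialOrder σ) (g : σ → R) (m : Ideal R) {d : ℕ}
    {φ : MvPolynomial σ k} (hφ : φ.IsHomogeneous d) (hφ0 : φ ≠ 0)
    (h : aeval g φ ∈ m * Ideal.span (Set.range g) ^ d) (hg : ∀ i, g i ∈ m)
    (C : Submodule k R) (K : ℕ)
    (hC : ⊤ ≤ C ⊔ (Ideal.span (Set.range g) ⊔ m ^ K).restrictScalars k) :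
    ⊤ ≤ C * Submodule.span k (powProd g '' {δ | δ.degree < K ∧ ¬ o.degree φ ≤ δ}) ⊔
      (m ^ K).restrictScalars k := by
  set I := Ideal.span (Set.range g) with hI
  set W := C * Submodule.span k (powProd g '' {δ | δ.degree < K ∧ ¬ o.degree φ ≤ δ})
  have key : ∀ j ≤ K, ⊤ ≤ W ⊔ (I ^ j ⊔ m ^ K).restrictScalars k := by
    intro j
    induction j with
    | zero => intro _; simp
    | succ j ih =>
      intro hj
      refine (ih (by lia)).trans (sup_le le_sup_left ?_)
      intro x hx
      set V := W ⊔ (I ^ (j + 1) ⊔ m ^ K).restrictScalars k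
      have hmK : ∀ x ∈ m ^ K, x ∈ V := fun x hx =>
        Submodule.mem_sup_right (Ideal.mem_sup_right hx)
      have hE : ∀ e ∈ Ideal.span (powProd g '' {δ | δ.degree = j ∧ ¬ o.degree φ ≤ δ}),
          ∀ r : R, r * e ∈ V := by
        intro e he
        induction he using Submodule.span_induction with
        | zero => intro r; simp
        | add a b _ _ ha hb => intro r; rw [mul_add]; exact V.add_mem (ha r) (hb r)
        | smul a b _ hb => intro r; rw [smul_eq_mul, ← mul_assoc]; exact hb _
        | mem y hy =>
          obtain ⟨α, ⟨hα, hαβ⟩, rfl⟩ := hy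
          intro r
          obtain ⟨c, hc, v, hv, rfl⟩ := Submodule.mem_sup.1 (hC (Submodule.mem_top (x := r)))
          obtain ⟨i, hi, u, hu, rfl⟩ := Submodule.mem_sup.1 hv
          rw [add_mul, add_mul]
          refine V.add_mem ?_ (V.add_mem ?_ ?_)
          · exact Submodule.mem_sup_left (Submodule.mul_mem_mul hc
              (Submodule.subset_span ⟨α, ⟨by simp only [hα]; lia, hαβ⟩, rfl⟩))
          · refine Submodule.mem_sup_right (Ideal.mem_sup_left ?_)
            rw [pow_succ', ← hα]
            exact Ideal.mul_mem_mul hi (powProd_mem g α)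
          · exact hmK _ (Ideal.mul_mem_right _ _ hu)
      obtain ⟨a, ha, b, hb, rfl⟩ := Submodule.mem_sup.1 hx
      refine V.add_mem ?_ (hmK b hb)
      obtain ⟨e, he, u, hu, rfl⟩ :=
        Submodule.mem_sup.1 (span_range_pow_le o g m hφ hφ0 h j K ha)
      exact V.add_mem (by simpa using hE e he 1) (hmK u (Ideal.mul_le_left hu))
  have hIm : I ≤ m := by
    rw [hI, Ideal.span_le]
    rintro _ ⟨i, rfl⟩
    exact hg i
  refine (key K le_rfl).trans (sup_le_sup_left ?_ _)
  exact sup_le (Ideal.pow_right_mono hIm K) le_rfl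

end PowerProducts

section LocalCount

variable {n : ℕ} {k : Type*} [Field k]

/-- The exponents bounded by `b` in each coordinate. -/
noncomputable def box (b : Fin n → ℕ) : Finset (Fin n →₀ ℕ) :=
  (Fintype.piFinset fun i => Finset.range (b i)).map Finsupp.equivFunOnFinite.symm.toEmbedding

lemma mem_box {b : Fin n → ℕ} {α : Fin n →₀ ℕ} : α ∈ box b ↔ ∀ i, α i < b i := by
  simp only [box, Finset.mem_map_equiv, Fintype.mem_piFinset, Finset.mem_range]
  rfl

lemma card_box (b : Fin n → ℕ) : (box b).card = ∏ i, b i := by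
  simp [box]

lemma mem_idealOfVars {q : MvPolynomial (Fin n) k} (hq : constantCoeff q = 0) :
    q ∈ idealOfVars (Fin n) k := by
  rw [← pow_one (idealOfVars (Fin n) k), mem_pow_idealOfVars_iff']
  intro α hα
  have : α = 0 := by
    rw [← Finsupp.degree_eq_zero_iff]; lia
  rwa [this, ← constantCoeff_eq]

lemma mem_sup_pow_of_mul_mem {s x : MvPolynomial (Fin n) k} (hs : constantCoeff s ≠ 0)
    {I : Ideal (MvPolynomial (Fin n) k)} (h : s * x ∈ I) (K : ℕ) :
    x ∈ I ⊔ idealOfVars (Fin n) k ^ K := by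
  set t := C (constantCoeff s)⁻¹ * s with ht
  have h1 : 1 - t ∈ idealOfVars (Fin n) k := by
    refine mem_idealOfVars ?_
    simp [ht, inv_mul_cancel₀ hs]
  obtain ⟨q, hq⟩ : t ∣ 1 - (1 - t) ^ K := by
    simpa using sub_dvd_pow_sub_pow 1 (1 - t) K
  have : x = (C (constantCoeff s)⁻¹ * q) * (s * x) + x * (1 - t) ^ K := by
    have : x = x * (1 - (1 - t) ^ K) + x * (1 - t) ^ K := by ring
    rw [hq, ht] at this
    linear_combination this
  rw [this]
  exact Submodule.add_mem_sup (I.mul_mem_left _ h)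
    (Ideal.mul_mem_left _ _ (Ideal.pow_mem_pow h1 K))

lemma pow_le_card_of_top_le_span_sup {L : ℕ} (F : Finset (MvPolynomial (Fin n) k))
    (hF : ⊤ ≤ Submodule.span k (F : Set (MvPolynomial (Fin n) k)) ⊔
      (idealOfVars (Fin n) k ^ (n * L)).restrictScalars k) (hn : 0 < n) :
    L ^ n ≤ F.card := by
  classical
  let π : MvPolynomial (Fin n) k →ₗ[k] (box (fun _ : Fin n => L) → k) :=
    LinearMap.pi fun γ => lcoeff k γ.1
  have hker : ∀ p ∈ idealOfVars (Fin n) k ^ (n * L), π p = 0 := by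
    intro p hp
    ext ⟨γ, hγ⟩
    refine (mem_pow_idealOfVars_iff' _ _).1 hp γ ?_
    rw [mem_box] at hγ
    rw [Finsupp.degree_eq_sum]
    have : ∑ i : Fin n, γ i < ∑ i : Fin n, L :=
      Finset.sum_lt_sum_of_nonempty ⟨⟨0, hn⟩, Finset.mem_univ _⟩ fun i _ => hγ i
    simpa using this
  have htop : Submodule.span k ((F.image π : Finset _) : Set (box (fun _ : Fin n => L) → k)) = ⊤ := by
    rw [eq_top_iff]
    intro v _
    have hv : π (∑ γ, monomial γ.1 (v γ)) = v := by
      ext γ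
      simp only [π, LinearMap.pi_apply, lcoeff_apply, coeff_sum, coeff_monomial]
      simp
    obtain ⟨a, ha, b, hb, hab⟩ :=
      Submodule.mem_sup.1 (hF (Submodule.mem_top (x := ∑ γ, monomial γ.1 (v γ))))
    rw [← hv, ← hab, map_add, hker b hb, add_zero, Finset.coe_image, ← Submodule.map_span]
    exact Submodule.mem_map_of_mem ha
  have h1 := finrank_span_finset_le_card (R := k) (F.image π)
  rw [Set.finrank, htop, finrank_top, Module.finrank_fintype_fun_eq_card, Fintype.card_coe, card_box] at h1
  simpa using h1.trans Finset.card_image_le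

/-- A system of parameters at the origin is analytically independent. -/
theorem eq_zero_of_aeval_mem (hn : 0 < n) {g : Fin n → MvPolynomial (Fin n) k}
    (hg : ∀ i, g i ∈ idealOfVars (Fin n) k) {s : MvPolynomial (Fin n) k}
    (hs : constantCoeff s ≠ 0) {N : ℕ} (hN : ∀ i, s * X i ^ N ∈ Ideal.span (Set.range g))
    {φ : MvPolynomial (Fin n) k} {d : ℕ} (hφ : φ.IsHomogeneous d)
    (h : aeval g φ ∈ idealOfVars (Fin n) k * Ideal.span (Set.range g) ^ d) : φ = 0 := by
  classical
  by_contra hφ0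
  let o : MonomialOrder (Fin n) := MonomialOrder.lex
  set β := o.degree φ with hβ
  have count : ∀ L : ℕ, L ^ n ≤ N ^ n * ∑ i, β i * (n * L) ^ (n - 1) := by
    intro L
    set K := n * L
    let Cs : Submodule k (MvPolynomial (Fin n) k) :=
      Submodule.span k ((fun γ => monomial γ 1) '' (box (fun _ : Fin n => N) : Set (Fin n →₀ ℕ)))
    have hC : ⊤ ≤ Cs ⊔ (Ideal.span (Set.range g) ⊔ idealOfVars (Fin n) k ^ K).restrictScalars k := by
      intro p _
      rw [p.as_sum]
      refine Submodule.sum_mem _ fun γ _ => ?_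
      by_cases hγ : γ ∈ box (fun _ : Fin n => N)
      · refine Submodule.mem_sup_left ?_
        rw [← mul_one (coeff γ p), ← smul_eq_mul, ← smul_monomial]
        exact Submodule.smul_mem _ _ (Submodule.subset_span ⟨γ, hγ, rfl⟩)
      · refine Submodule.mem_sup_right ?_
        rw [mem_box] at hγ
        push Not at hγ
        obtain ⟨i, hi⟩ := hγ
        have : Finsupp.single i N ≤ γ := by simpa using hi
        obtain ⟨δ, rfl⟩ := exists_add_of_le this
        rw [← one_mul (coeff _ p), ← monomial_mul, ← X_pow_eq_monomial]
        exact Ideal.mul_mem_right _ _ (mem_sup_pow_of_mul_mem hs (hN i) K)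
    let T : Finset (Fin n →₀ ℕ) :=
      Finset.univ.biUnion fun i => box (Function.update (fun _ => K) i (β i))
    have hT : {δ : Fin n →₀ ℕ | δ.degree < K ∧ ¬ β ≤ δ} ⊆ T := by
      rintro δ ⟨h1, h2⟩
      obtain ⟨i, hi⟩ : ∃ i, δ i < β i := by
        by_contra! hcon
        exact h2 hcon
      simp only [T, Finset.coe_biUnion, Set.mem_iUnion]
      refine ⟨i, Finset.mem_univ _, Finset.mem_coe.2 (mem_box.2 fun j => ?_)⟩
      rcases eq_or_ne j i with rfl | hj
      · simpa using hi
      · simpa [hj] using (Finsupp.le_degree j δ).trans_lt h1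
    have hTc : T.card ≤ ∑ i, β i * K ^ (n - 1) := by
      refine Finset.card_biUnion_le.trans (Finset.sum_le_sum fun i _ => ?_)
      rw [card_box, ← Finset.mul_prod_erase _ _ (Finset.mem_univ i)]
      rw [Function.update_self, Finset.prod_congr rfl (g := fun _ => K)]
      · simp [Finset.card_erase_of_mem]
      · intro j hj
        simp [(Finset.mem_erase.1 hj).1]
    let F : Finset (MvPolynomial (Fin n) k) :=
      Finset.image₂ (· * ·) ((box fun _ : Fin n => N).image fun γ => monomial γ 1)
        (T.image (powProd g))
    have hFc : F.card ≤ N ^ n * T.card := by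
      refine (Finset.card_image₂_le _ _ _).trans
        (Nat.mul_le_mul (Finset.card_image_le.trans ?_) Finset.card_image_le)
      simp [card_box]
    refine (pow_le_card_of_top_le_span_sup F ?_ hn).trans (hFc.trans (Nat.mul_le_mul_left _ hTc))
    refine (top_le_mul_span_sup o g _ hφ hφ0 h hg Cs K hC).trans (sup_le_sup_right ?_ _)
    rw [Submodule.span_mul_span]
    refine Submodule.span_mono ?_
    rw [Finset.coe_image₂, Finset.coe_image, Finset.coe_image]
    exact Set.image2_subset_left (Set.image_mono hT)
  obtain ⟨r, rfl⟩ : ∃ r, n = r + 1 := ⟨n - 1, by lia⟩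
  set c := N ^ (r + 1) * ∑ i, β i * (r + 1) ^ r with hc
  have h1 := count (c + 1)
  have h2 : N ^ (r + 1) * ∑ i, β i * ((r + 1) * (c + 1)) ^ (r + 1 - 1) = (c + 1) ^ r * c := by
    rw [hc, Nat.add_sub_cancel]
    simp_rw [mul_pow, ← mul_assoc, ← Finset.sum_mul]
    ring
  rw [h2, pow_succ] at h1
  have := Nat.le_of_mul_le_mul_left h1 (by positivity)
  lia

end LocalCount

section TorusPoints

variable {n : ℕ} {k : Type*} [Field k]

/-- The analytic independence of a system of parameters at an arbitrary rational point. -/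
theorem eq_zero_of_aeval_mem_ker (hn : 0 < n) (p : Fin n → k) {g : Fin n → MvPolynomial (Fin n) k}
    (hg : ∀ i, eval p (g i) = 0) {s : MvPolynomial (Fin n) k} (hs : eval p s ≠ 0) {N : ℕ}
    (hN : ∀ i, s * (X i - C (p i)) ^ N ∈ Ideal.span (Set.range g))
    {φ : MvPolynomial (Fin n) k} {d : ℕ} (hφ : φ.IsHomogeneous d)
    (h : aeval g φ ∈ RingHom.ker (eval p) * Ideal.span (Set.range g) ^ d) : φ = 0 := by
  let τ : MvPolynomial (Fin n) k →ₐ[k] MvPolynomial (Fin n) k := aeval fun i => X i + C (p i)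
  have hτ : ∀ q, constantCoeff (τ q) = eval p q := by
    intro q
    have : (constantCoeff.comp (τ : MvPolynomial (Fin n) k →+* MvPolynomial (Fin n) k)) =
        eval p := by
      ext <;> simp [τ]
    exact DFunLike.congr_fun this q
  have hI : (Ideal.span (Set.range g)).map τ = Ideal.span (Set.range fun i => τ (g i)) := by
    rw [Ideal.map_span, ← Set.range_comp]
    rfl
  refine eq_zero_of_aeval_mem hn (g := fun i => τ (g i)) (s := τ s) (N := N) ?_ ?_ ?_ hφ ?_
  · exact fun i => mem_idealOfVars (by rw [hτ, hg])
  · rwa [hτ]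
  · intro i
    rw [← hI]
    have := Ideal.mem_map_of_mem τ (hN i)
    simpa [τ] using this
  · have h1 := Ideal.mem_map_of_mem τ h
    rw [Ideal.map_mul, Ideal.map_pow, hI] at h1
    have h2 : τ (aeval g φ) = aeval (fun i => τ (g i)) φ := by
      rw [← comp_aeval_apply]
    rw [← h2]
    refine Ideal.mul_mono_left ?_ h1
    rw [Ideal.map_le_iff_le_comap]
    intro q hq
    exact mem_idealOfVars (by rw [hτ]; exact hq)

/-- Polynomials which separate the points of a finite set. -/
lemma exists_separating (S : Finset (Fin n → k)) (p : Fin n → k) :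
    ∃ w : MvPolynomial (Fin n) k, eval p w = 1 ∧ ∀ q ∈ S, q ≠ p → eval q w = 0 := by
  classical
  have : ∀ q : Fin n → k, ∃ l : MvPolynomial (Fin n) k,
      eval p l = 1 ∧ (q ≠ p → eval q l = 0) := by
    intro q
    by_cases hq : q = p
    · exact ⟨1, by simp, fun h => (h hq).elim⟩
    · obtain ⟨i, hi⟩ := Function.ne_iff.1 hq
      refine ⟨C (p i - q i)⁻¹ * (X i - C (q i)), ?_, fun _ => by simp⟩
      simp [inv_mul_cancel₀ (sub_ne_zero.2 (Ne.symm hi))]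
  choose l hl1 hl2 using this
  refine ⟨∏ q ∈ S, l q, ?_, fun q hq hqp => ?_⟩
  · rw [map_prod]
    exact Finset.prod_eq_one fun q _ => hl1 q
  · rw [map_prod]
    exact Finset.prod_eq_zero hq (hl2 q hqp)

/-- At an isolated torus zero of `g`, the ideal of `g` is locally primary to the maximal
ideal of the point. -/
lemma exists_mul_pow_mem [IsAlgClosed k] {g : Fin n → MvPolynomial (Fin n) k}
    {S : Finset (Fin n → k)}
    (hS : ∀ z, z ∈ S ↔ (∀ i, z i ≠ 0) ∧ ∀ i, eval z (g i) = 0) {p : Fin n → k} (hp : p ∈ S) :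
    ∃ s : MvPolynomial (Fin n) k, eval p s ≠ 0 ∧
      ∃ N : ℕ, ∀ i, s * (X i - C (p i)) ^ N ∈ Ideal.span (Set.range g) := by
  obtain ⟨w, hw1, hw2⟩ := exists_separating S p
  let s₀ : MvPolynomial (Fin n) k := w * ∏ i, X i
  let J : Ideal (MvPolynomial (Fin n) k) := Ideal.span (Set.range fun i => s₀ * (X i - C (p i)))
  have hJ : J ≤ (Ideal.span (Set.range g)).radical := by
    rw [Ideal.span_le]
    rintro _ ⟨i, rfl⟩
    rw [SetLike.mem_coe, ← vanishingIdeal_zeroLocus_eq_radical (K := k), mem_vanishingIdeal_iff]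
    intro z hz
    rw [zeroLocus_span] at hz
    have hz' : ∀ i, eval z (g i) = 0 := fun i => hz _ ⟨i, rfl⟩
    change eval z (s₀ * (X i - C (p i))) = 0
    simp only [s₀, map_mul, map_prod, eval_X, map_sub, eval_C]
    by_cases h0 : ∀ i, z i ≠ 0
    · have hzS := (hS z).2 ⟨h0, hz'⟩
      by_cases hzp : z = p
      · simp [hzp]
      · simp [hw2 z hzS hzp]
    · push Not at h0
      obtain ⟨j, hj⟩ := h0
      rw [Finset.prod_eq_zero (Finset.mem_univ j) hj]
      simp
  obtain ⟨N, hN⟩ := Ideal.exists_pow_le_of_le_radical_of_fg hJ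
    (Submodule.fg_span (Set.finite_range _))
  refine ⟨s₀ ^ N, ?_, N, fun i => ?_⟩
  · rw [map_pow]
    refine pow_ne_zero _ ?_
    simp only [s₀, map_mul, hw1, map_prod, eval_X, one_mul]
    exact Finset.prod_ne_zero_iff.2 fun i _ => ((hS p).1 hp).1 i
  · rw [← mul_pow]
    exact hN (Ideal.pow_mem_pow (I := J) (Ideal.subset_span ⟨i, rfl⟩) N)

/-- Power products of the equations, multiplied by polynomials separating the isolated torus
zeros and homogenized by `M`, are linearly independent. -/
theorem coeff_eq_zero_of_sum_eq_zero [IsAlgClosed k] (hn : 0 < n)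
    {g : Fin n → MvPolynomial (Fin n) k} {S : Finset (Fin n → k)}
    (hS : ∀ z, z ∈ S ↔ (∀ i, z i ≠ 0) ∧ ∀ i, eval z (g i) = 0)
    {w : (Fin n → k) → MvPolynomial (Fin n) k} (hw1 : ∀ p, eval p (w p) = 1)
    (hw2 : ∀ p, ∀ q ∈ S, q ≠ p → eval q (w p) = 0)
    {M : MvPolynomial (Fin n) k} (hM : ∀ p ∈ S, eval p M ≠ 0) (K : ℕ)
    (D : Finset (Fin n →₀ ℕ)) (c : (Fin n → k) → (Fin n →₀ ℕ) → k)
    (h : ∑ α ∈ D, (∑ q ∈ S, c q α • (w q * M ^ (K - α.degree))) * powProd g α = 0) :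
    ∀ α ∈ D, ∀ p ∈ S, c p α = 0 := by
  classical
  suffices H : ∀ d, ∀ α ∈ D, α.degree = d → ∀ p ∈ S, c p α = 0 from
    fun α hα => H _ α hα rfl
  intro d
  induction d using Nat.strong_induction_on with
  | _ d ih =>
  intro α₀ hα₀ hα₀d p hp
  obtain ⟨s, hs, N, hN⟩ := exists_mul_pow_mem hS hp
  have hg : ∀ i, eval p (g i) = 0 := ((hS p).1 hp).2
  set I := Ideal.span (Set.range g) with hI
  set m : Ideal (MvPolynomial (Fin n) k) := RingHom.ker (eval p)
  have hIm : I ≤ m := by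
    rw [hI, Ideal.span_le]
    rintro _ ⟨i, rfl⟩
    exact hg i
  let μ : k := eval p M ^ (K - d)
  have hμ : μ ≠ 0 := pow_ne_zero _ (hM p hp)
  let φ : MvPolynomial (Fin n) k := ∑ α ∈ D with α.degree = d, monomial α (c p α)
  have hφ : φ.IsHomogeneous d :=
    IsHomogeneous.sum _ _ _ fun α hα => isHomogeneous_monomial _ (Finset.mem_filter.1 hα).2
  have hφg : aeval g φ = ∑ α ∈ D, if α.degree = d then c p α • powProd g α else 0 := by
    rw [map_sum, Finset.sum_filter]
    refine Finset.sum_congr rfl fun α _ => ?_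
    split_ifs
    · rw [aeval_monomial, Algebra.smul_def]
      rfl
    · rfl
  have hmem : C μ * aeval g φ ∈ m * I ^ d := by
    have e : C μ * aeval g φ = ∑ α ∈ D, (C μ * (if α.degree = d then c p α • powProd g α else 0) -
        (∑ q ∈ S, c q α • (w q * M ^ (K - α.degree))) * powProd g α) := by
      rw [Finset.sum_sub_distrib, h, sub_zero, hφg, Finset.mul_sum]
    rw [e]
    refine Ideal.sum_mem _ fun α hα => ?_
    rcases lt_trichotomy α.degree d with hd | hd | hd
    · rw [if_neg hd.ne, Finset.sum_eq_zero]
      · simp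
      · intro q hq
        rw [ih _ hd α hα rfl q hq, zero_smul]
    · rw [if_pos hd, smul_eq_C_mul, ← mul_assoc, ← sub_mul]
      refine Ideal.mul_mem_mul ?_ (hd ▸ powProd_mem g α)
      rw [RingHom.mem_ker, map_sub, map_sum, Finset.sum_eq_single_of_mem p hp]
      · simp [hd, hw1, μ, mul_comm, smul_eval]
      · intro q _ hqp
        simp [smul_eval, hw2 q p hp hqp.symm]
    · rw [if_neg hd.ne', mul_zero, zero_sub]
      refine neg_mem (Ideal.mul_mem_left _ _ ?_)
      have h1 : powProd g α ∈ I ^ (d + 1) := Ideal.pow_le_pow_right hd (powProd_mem g α)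
      rw [pow_succ'] at h1
      exact Ideal.mul_mono_left hIm h1
  have hmem' : aeval g φ ∈ m * I ^ d := by
    have := Ideal.mul_mem_left _ (C μ⁻¹) hmem
    rwa [← mul_assoc, ← C_mul, inv_mul_cancel₀ hμ, C_1, one_mul] at this
  have hφ0 : φ = 0 := eq_zero_of_aeval_mem_ker hn p hg hs hN hφ hmem'
  have hcoeff : coeff α₀ φ = c p α₀ := by
    simp [φ, coeff_sum, coeff_monomial, hα₀, hα₀d]
  rw [← hcoeff, hφ0, coeff_zero]

end TorusPoints

section Supports

open scoped Pointwise

variable {n : ℕ} {k : Type*} [Field k]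

/-- An exponent vector viewed as a real vector. -/
def realExp (α : Fin n →₀ ℕ) : Fin n → ℝ := fun i => (α i : ℝ)

lemma realExp_injective : Function.Injective (realExp (n := n)) := by
  intro α β h
  ext i
  exact Nat.cast_injective (R := ℝ) (congrFun h i)

lemma finite_realExp_mem {Z : Set (Fin n → ℝ)} (hZ : Bornology.IsBounded Z) :
    {γ : Fin n →₀ ℕ | realExp γ ∈ Z}.Finite := by
  obtain ⟨r, hr⟩ := hZ.subset_closedBall 0
  refine (box (fun _ : Fin n => ⌊r⌋₊ + 1)).finite_toSet.subset fun γ hγ => ?_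
  rw [Finset.mem_coe, mem_box]
  intro i
  rw [Nat.lt_succ_iff]
  refine Nat.le_floor ?_
  have h1 := norm_le_pi_norm (realExp γ) i
  have h2 : ‖realExp γ‖ ≤ r := by simpa using hr hγ
  have h3 : ‖realExp γ i‖ = γ i := by simp [realExp]
  linarith

/-- All exponents of `q` lie in `Z`. -/
def SupportedOn (q : MvPolynomial (Fin n) k) (Z : Set (Fin n → ℝ)) : Prop :=
  ∀ γ ∈ q.support, realExp γ ∈ Z

lemma SupportedOn.mul {p q : MvPolynomial (Fin n) k} {Y Z : Set (Fin n → ℝ)}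
    (hp : SupportedOn p Y) (hq : SupportedOn q Z) : SupportedOn (p * q) (Y + Z) := by
  classical
  intro γ hγ
  obtain ⟨a, ha, b, hb, rfl⟩ := Finset.mem_add.1 (support_mul p q hγ)
  refine ⟨_, hp a ha, _, hq b hb, ?_⟩
  ext i
  simp [realExp]

lemma supportedOn_one {P : Set (Fin n → ℝ)} (hne : P.Nonempty) :
    SupportedOn (1 : MvPolynomial (Fin n) k) ((0 : ℝ) • P) := by
  intro γ hγ
  rw [Set.zero_smul_set hne]
  have : γ = 0 := by
    by_contra h
    exact mem_support_iff.1 hγ (by rw [coeff_one, if_neg (Ne.symm h)])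
  subst this
  ext i
  simp [realExp]

lemma SupportedOn.pow {q : MvPolynomial (Fin n) k} {P : Set (Fin n → ℝ)} (hP : Convex ℝ P)
    (hne : P.Nonempty) (hq : SupportedOn q P) (e : ℕ) : SupportedOn (q ^ e) ((e : ℝ) • P) := by
  induction e with
  | zero => simpa using supportedOn_one hne
  | succ e ih =>
    rw [pow_succ, Nat.cast_succ, hP.add_smul (Nat.cast_nonneg e) zero_le_one, one_smul]
    exact ih.mul hq

lemma supportedOn_powProd {g : Fin n → MvPolynomial (Fin n) k} {P : Set (Fin n → ℝ)}
    (hP : Convex ℝ P) (hne : P.Nonempty) (hg : ∀ i, SupportedOn (g i) P) (α : Fin n →₀ ℕ) :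
    SupportedOn (powProd g α) ((α.degree : ℝ) • P) := by
  classical
  have : ∀ s : Finset (Fin n),
      SupportedOn (∏ i ∈ s, g i ^ α i) (((∑ i ∈ s, α i : ℕ) : ℝ) • P) := by
    intro s
    induction s using Finset.induction_on with
    | empty => simpa using supportedOn_one hne
    | insert i s hi ih =>
      rw [Finset.prod_insert hi, Finset.sum_insert hi, Nat.cast_add,
        hP.add_smul (Nat.cast_nonneg _) (Nat.cast_nonneg _)]
      exact ((hg i).pow hP hne _).mul ih
  exact this α.support

/-- The exponents of degree at most `K`. -/
noncomputable def simplex (n K : ℕ) : Finset (Fin n →₀ ℕ) :=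
  {α ∈ box fun _ : Fin n => K + 1 | α.degree ≤ K}

lemma mem_simplex {K : ℕ} {α : Fin n →₀ ℕ} : α ∈ simplex n K ↔ α.degree ≤ K := by
  rw [simplex, Finset.mem_filter, mem_box, and_iff_right_iff_imp]
  exact fun h i => Nat.lt_succ_of_le ((Finsupp.le_degree i α).trans h)

lemma pow_le_factorial_mul_card_simplex (n K : ℕ) : K ^ n ≤ n.factorial * (simplex n K).card := by
  have h1 : (Finset.finsuppAntidiag (Finset.univ : Finset (Fin (n + 1))) K).card ≤
      (simplex n K).card := by
    refine Finset.card_le_card_of_injOn Finsupp.tail ?_ ?_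
    · intro x hx
      rw [Finset.mem_coe, Finset.mem_finsuppAntidiag, Fin.sum_univ_succ] at hx
      rw [Finset.mem_coe, mem_simplex, Finsupp.degree_eq_sum]
      simp only [Finsupp.tail_apply]
      lia
    · intro x hx y hy hxy
      rw [Finset.mem_coe, Finset.mem_finsuppAntidiag, Fin.sum_univ_succ] at hx hy
      have hs : ∀ i : Fin n, x i.succ = y i.succ := fun i => DFunLike.congr_fun hxy i
      ext i
      refine Fin.cases ?_ hs i
      have := hx.1.trans hy.1.symm
      simpa [hs] using this
  rw [Finset.card_finsuppAntidiag_nat_eq_choose, Finset.card_fin,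
    show n + 1 + K - 1 = n + K by lia, ← Nat.choose_symm_add] at h1
  refine le_trans ?_ (Nat.mul_le_mul_left _ h1)
  rw [← Nat.descFactorial_eq_factorial_mul_choose]
  refine le_trans (Nat.pow_le_pow_left ?_ n) (Nat.pow_sub_le_descFactorial (n + K) n)
  lia

/-- The counting inequality from linear independence. -/
theorem card_mul_card_simplex_le [IsAlgClosed k] (hn : 0 < n)
    {g : Fin n → MvPolynomial (Fin n) k} {S : Finset (Fin n → k)}
    (hS : ∀ z, z ∈ S ↔ (∀ i, z i ≠ 0) ∧ ∀ i, eval z (g i) = 0)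
    {P : Set (Fin n → ℝ)} (hP : Convex ℝ P) (hPb : Bornology.IsBounded P)
    {a : Fin n →₀ ℕ} (ha : realExp a ∈ P) (hg : ∀ i, SupportedOn (g i) P) :
    ∃ r : ℝ, ∀ K : ℕ, (S.card * (simplex n K).card) ≤
      {γ : Fin n →₀ ℕ | realExp γ ∈ Metric.closedBall 0 r + (K : ℝ) • P}.ncard := by
  classical
  choose w hw1 hw2 using exists_separating (n := n) S
  have hne : P.Nonempty := ⟨_, ha⟩
  have hb : Bornology.IsBounded (realExp '' (S.biUnion fun p => (w p).support : Set (Fin n →₀ ℕ))) :=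
    ((Finset.finite_toSet _).image _).isBounded
  obtain ⟨r, hr⟩ := hb.subset_closedBall 0
  refine ⟨r, fun K => ?_⟩
  let M : MvPolynomial (Fin n) k := monomial a 1
  have hM : ∀ p ∈ S, eval p M ≠ 0 := by
    intro p hp
    simp only [M, eval_monomial, one_mul]
    exact Finset.prod_ne_zero_iff.2 fun i _ => pow_ne_zero _ (((hS p).1 hp).1 i)
  have hMs : SupportedOn M P := by
    intro γ hγ
    rw [Finset.mem_singleton.1 (support_monomial_subset hγ)]
    exact ha
  let v : (Fin n →₀ ℕ) × (Fin n → k) → MvPolynomial (Fin n) k :=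
    fun x => w x.2 * M ^ (K - x.1.degree) * powProd g x.1
  have hv : LinearIndepOn k v ((simplex n K ×ˢ S : Finset _) : Set _) := by
    rw [linearIndepOn_finset_iff]
    intro c hc x hx
    rw [Finset.mem_product] at hx
    refine coeff_eq_zero_of_sum_eq_zero hn hS hw1 hw2 hM K (simplex n K) (fun p α => c (α, p)) ?_
      x.1 hx.1 x.2 hx.2
    rw [Finset.sum_product] at hc
    rw [← hc]
    refine Finset.sum_congr rfl fun α _ => ?_
    rw [Finset.sum_mul]
    exact Finset.sum_congr rfl fun p _ => smul_mul_assoc _ _ _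
  have hfin : {γ : Fin n →₀ ℕ | realExp γ ∈ Metric.closedBall 0 r + (K : ℝ) • P}.Finite :=
    finite_realExp_mem (Metric.isBounded_closedBall.add (hPb.smul₀ _))
  have hsupp : ∀ x ∈ simplex n K ×ˢ S,
      SupportedOn (v x) (Metric.closedBall 0 r + (K : ℝ) • P) := by
    intro x hx
    rw [Finset.mem_product, mem_simplex] at hx
    have hKP : (K : ℝ) • P = ((K - x.1.degree : ℕ) : ℝ) • P + (x.1.degree : ℝ) • P := by
      rw [← hP.add_smul (Nat.cast_nonneg _) (Nat.cast_nonneg _), ← Nat.cast_add,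
        Nat.sub_add_cancel hx.1]
    rw [hKP, ← add_assoc]
    refine (SupportedOn.mul ?_ (hMs.pow hP hne _)).mul (supportedOn_powProd hP hne hg _)
    intro γ hγ
    exact hr ⟨γ, Finset.mem_coe.2 (Finset.mem_biUnion.2 ⟨_, hx.2, hγ⟩), rfl⟩
  let B := hfin.toFinset.image fun γ => (monomial γ (1 : k))
  have hspan : Set.range (fun x : (simplex n K ×ˢ S : Finset _) => v x) ≤
      Submodule.span k (B : Set (MvPolynomial (Fin n) k)) := by
    rintro _ ⟨⟨x, hx⟩, rfl⟩
    change v x ∈ Submodule.span k _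
    rw [(v x).as_sum]
    refine Submodule.sum_mem _ fun γ hγ => ?_
    rw [← mul_one (coeff γ (v x)), ← smul_eq_mul, ← smul_monomial]
    refine Submodule.smul_mem _ _ (Submodule.subset_span ?_)
    exact Finset.mem_coe.2 (Finset.mem_image.2 ⟨γ, hfin.mem_toFinset.2 (hsupp x hx γ hγ), rfl⟩)
  have hcard := linearIndependent_le_span_aux' (fun x : (simplex n K ×ˢ S : Finset _) => v x) hv
    (B : Set (MvPolynomial (Fin n) k)) hspan
  rw [Fintype.card_coe, Finset.card_product] at hcard
  rw [Set.ncard_eq_toFinset_card _ hfin, mul_comm]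
  refine hcard.trans ?_
  simpa only [Finset.coe_sort_coe, Fintype.card_coe] using Finset.card_image_le

end Supports

section Volume

open scoped Pointwise Topology
open MeasureTheory Filter

variable {n : ℕ}

lemma ncard_le_card_cthickening {P : Set (Fin n → ℝ)} (hPb : Bornology.IsBounded P) {r ε : ℝ}
    {K : ℕ} (hK : 0 < K) (hr : r / K ≤ ε) :
    {γ : Fin n →₀ ℕ | realExp γ ∈ Metric.closedBall 0 r + (K : ℝ) • P}.ncard ≤
      Nat.card ↑(Metric.cthickening ε P ∩
        (K : ℝ)⁻¹ • (Submodule.span ℤ (Set.range (Pi.basisFun ℝ (Fin n))) : Set (Fin n → ℝ))) := by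
  have hK' : (0 : ℝ) < K := Nat.cast_pos.2 hK
  rw [Nat.card_coe_set_eq]
  refine Set.ncard_le_ncard_of_injOn (fun γ => (K : ℝ)⁻¹ • realExp γ) ?_ ?_ ?_
  · rintro γ ⟨b, hb, _, ⟨x, hx, rfl⟩, hγ⟩
    refine ⟨?_, Set.smul_mem_smul_set ?_⟩
    · refine Metric.mem_cthickening_of_dist_le _ x _ _ hx (le_trans ?_ hr)
      have : (K : ℝ)⁻¹ • realExp γ - x = (K : ℝ)⁻¹ • b := by
        rw [← hγ]
        simp only [smul_add, inv_smul_smul₀ hK'.ne', add_sub_cancel_right]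
      rw [dist_eq_norm, this, norm_smul, norm_inv, Real.norm_of_nonneg hK'.le, inv_mul_eq_div]
      gcongr
      simpa using hb
    · rw [SetLike.mem_coe, Module.Basis.mem_span_iff_repr_mem]
      intro i
      exact ⟨(γ i : ℤ), by simp [realExp]⟩
  · exact fun x _ y _ h => realExp_injective (smul_right_injective _ (inv_ne_zero hK'.ne') h)
  · have h1 := (ZSpan.setFinite_inter (Pi.basisFun ℝ (Fin n))
      (hPb.cthickening.smul₀ (K : ℝ) : Bornology.IsBounded ((K : ℝ) • Metric.cthickening ε P))).image
      fun x => (K : ℝ)⁻¹ • x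
    refine h1.subset ?_
    rintro _ ⟨hx, y, hy, rfl⟩
    exact ⟨y, ⟨⟨_, hx, smul_inv_smul₀ hK'.ne' y⟩, hy⟩, rfl⟩

/-- Kushnirenko's bound, for systems with finitely many zeros in the torus. -/
theorem card_le_factorial_mul_volume {k : Type*} [Field k] [IsAlgClosed k] (hn : 0 < n)
    {g : Fin n → MvPolynomial (Fin n) k} {S : Finset (Fin n → k)}
    (hS : ∀ z, z ∈ S ↔ (∀ i, z i ≠ 0) ∧ ∀ i, eval z (g i) = 0)
    {P : Set (Fin n → ℝ)} (hP : Convex ℝ P) (hPc : IsCompact P)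
    {a : Fin n →₀ ℕ} (ha : realExp a ∈ P) (hg : ∀ i, SupportedOn (g i) P) :
    (S.card : ℝ) ≤ n.factorial * (volume P).toReal := by
  obtain ⟨r, hr⟩ := card_mul_card_simplex_le hn hS hP hPc.isBounded ha hg
  have hε : ∀ ε > 0, (S.card : ℝ) ≤ n.factorial * (volume (Metric.cthickening ε P)).toReal := by
    intro ε hε
    have hlim := (tendsto_card_div_pow_atTop_volume (Metric.cthickening ε P)
      hPc.isBounded.cthickening Metric.isClosed_cthickening.measurableSet
      ((hP.cthickening ε).addHaar_frontier volume)).const_mul (n.factorial : ℝ)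
    refine ge_of_tendsto hlim ?_
    have hrK : ∀ᶠ K : ℕ in atTop, r / K ≤ ε :=
      (tendsto_const_div_atTop_nhds_zero_nat r).eventually (ge_mem_nhds hε)
    filter_upwards [hrK, eventually_gt_atTop 0] with K hK hK0
    rw [Fintype.card_fin, ← mul_div_assoc, le_div_iff₀ (by positivity)]
    have h1 := (hr K).trans (ncard_le_card_cthickening hPc.isBounded hK0 hK)
    have h2 := pow_le_factorial_mul_card_simplex n K
    have h3 : S.card * K ^ n ≤ n.factorial * Nat.card ↑(Metric.cthickening ε P ∩
        (K : ℝ)⁻¹ • (Submodule.span ℤ (Set.range (Pi.basisFun ℝ (Fin n))) : Set (Fin n → ℝ))) :=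
      calc S.card * K ^ n ≤ S.card * (n.factorial * (simplex n K).card) :=
            Nat.mul_le_mul_left _ h2
        _ = n.factorial * (S.card * (simplex n K).card) := by ring
        _ ≤ _ := Nat.mul_le_mul_left _ h1
    exact_mod_cast h3
  have hlim : Tendsto (fun ε => n.factorial * (volume (Metric.cthickening ε P)).toReal)
      (𝓝[>] 0) (𝓝 (n.factorial * (volume P).toReal)) := by
    refine Tendsto.const_mul _ ?_
    exact (ENNReal.tendsto_toReal hPc.measure_lt_top.ne).comp
      ((tendsto_measure_cthickening_of_isCompact hPc).mono_left nhdsWithin_le_nhds)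
  exact ge_of_tendsto hlim (eventually_mem_nhdsWithin.mono hε)

end Volume

end GaussFiber

open GaussFiber in
/-- Let `f ∈ ℂ[z₁,…,zₙ]` and `y ∈ ℂⁿ` nonzero.  If the fiber of the
logarithmic Gauss map over `(y₁:…:yₙ)`, i.e. the set of `z` in the torus with `f(z) = 0` and
all 2×2 minors `yⱼ·zᵢ·∂f/∂zᵢ(z) − yᵢ·zⱼ·∂f/∂zⱼ(z)` vanishing, is finite, then its
cardinality is at most `n!·Volₙ(N_f)`, the normalized volume of the Newton polytope of `f`. -/
theorem gauss_fiber_card_le_normalized_volume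
    (n : ℕ) (f : MvPolynomial (Fin n) ℂ) (y : Fin n → ℂ) (hy : y ≠ 0)
    (S : Set (Fin n → ℂ))
    (hS : S = {z : Fin n → ℂ | (∀ i, z i ≠ 0) ∧ eval z f = 0 ∧
      ∀ i j : Fin n, y j * (z i * eval z (pderiv i f)) = y i * (z j * eval z (pderiv j f))})
    (Nf : Set (Fin n → ℝ))
    (hNf : Nf = convexHull ℝ
      ((fun (α : Fin n →₀ ℕ) (i : Fin n) => (α i : ℝ)) '' (f.support : Set (Fin n →₀ ℕ))))
    (hfin : S.Finite) :
    (S.ncard : ℝ) ≤ (n.factorial : ℝ) * (MeasureTheory.volume Nf).toReal := by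
  classical
  obtain ⟨i₀, hi₀⟩ := Function.ne_iff.1 hy
  have hi₀ : y i₀ ≠ 0 := hi₀
  have hn : 0 < n := i₀.pos
  by_cases hf : f = 0
  · exfalso
    have hsub : Set.range (fun (t : ℕ) (_ : Fin n) => ((t : ℂ) + 1)) ⊆ S := by
      rintro _ ⟨t, rfl⟩
      rw [hS]
      exact ⟨fun _ => Nat.cast_add_one_ne_zero t, by simp [hf], by simp [hf]⟩
    refine Set.infinite_range_of_injective (fun s t hst => ?_) (hfin.subset hsub)
    simpa using congrFun hst i₀
  obtain ⟨a, ha⟩ := Finset.nonempty_iff_ne_empty.2 (mt support_eq_empty.1 hf)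
  let g : Fin n → MvPolynomial (Fin n) ℂ := fun i =>
    if i = i₀ then f else C (y i₀) * (X i * pderiv i f) - C (y i) * (X i₀ * pderiv i₀ f)
  have hgS : ∀ z, z ∈ hfin.toFinset ↔ (∀ i, z i ≠ 0) ∧ ∀ i, eval z (g i) = 0 := by
    intro z
    rw [hfin.mem_toFinset, hS, Set.mem_ofPred_eq, and_congr_right_iff]
    intro _
    constructor
    · rintro ⟨h0, h⟩ i
      by_cases hi : i = i₀
      · simpa [g, hi] using h0
      · simpa [g, hi, sub_eq_zero] using h i i₀
    · intro h
      have h1 : ∀ i, y i₀ * (z i * eval z (pderiv i f)) = y i * (z i₀ * eval z (pderiv i₀ f)) := by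
        intro i
        by_cases hi : i = i₀
        · rw [hi]
        · simpa [g, hi, sub_eq_zero] using h i
      refine ⟨by simpa [g] using h i₀, fun i j => mul_left_cancel₀ hi₀ ?_⟩
      linear_combination y j * h1 i - y i * h1 j
  have hsupp : ∀ q : MvPolynomial (Fin n) ℂ, q.support ⊆ f.support → SupportedOn q Nf := by
    intro q hq γ hγ
    rw [hNf]
    exact subset_convexHull ℝ _ ⟨γ, hq hγ, rfl⟩
  have hX : ∀ i, (X i * pderiv i f).support ⊆ f.support := by
    intro i γ hγ
    rw [mem_support_iff] at hγ ⊢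
    intro h0
    rw [coeff_X_mul'] at hγ
    split_ifs at hγ with hi
    · have h1 : γ - Finsupp.single i 1 + Finsupp.single i 1 = γ :=
        tsub_add_cancel_of_le (Finsupp.single_le_iff.2
          (Nat.one_le_iff_ne_zero.2 (Finsupp.mem_support_iff.1 hi)))
      rw [coeff_pderiv, h1, h0, zero_mul] at hγ
      exact hγ rfl
    · exact hγ rfl
  have hg : ∀ i, SupportedOn (g i) Nf := by
    intro i
    refine hsupp _ ?_
    by_cases hi : i = i₀
    · simp [g, hi]
    · simp only [g, if_neg hi, ← smul_eq_C_mul]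
      refine (support_sub _ _ _).trans (Finset.union_subset ?_ ?_)
      · exact support_smul.trans (hX i)
      · exact support_smul.trans (hX i₀)
  rw [Set.ncard_eq_toFinset_card _ hfin]
  refine card_le_factorial_mul_volume hn hgS (hNf ▸ convex_convexHull ℝ _) ?_
    (hsupp f subset_rfl a ha) hg
  rw [hNf]
  exact ((Finset.finite_toSet _).image _).isCompact_convexHull ℝ
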